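/- arXiv:1510.06990 — 2 statements merged into one kernel-verified Lean document; each statement's English description precedes it below -/
import Mathlib

section
/- Let n, d ≥ 1, 0 < ε < 1 and 0 < δ < ε/2. There is a constant C = C(ε, δ, d), independent of n, such that every ς ∈ L¹(ℝ^n×ℝ^d) with ‖ς‖_{ℬ_ε} < ∞ can be written as ς = Σ_{m=0}^∞ ς_m^{(2^{−m})}, the series converging absolutely almost everywhere and in L¹(ℝ^n×ℝ^d), where each ς_m ∈ L¹(ℝ^n×ℝ^d) satisfies ς_m(α, v) = 0 whenever |v| > 1/4, and ‖ς_m‖_{ℬ_δ} ≤ C · 2^{−m(ε−2δ)} · ‖ς‖_{ℬ_ε} for all m ≥ 0. -/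
open MeasureTheory
open scoped ENNReal NNReal

noncomputable section

abbrev Rd (d : ℕ) : Type := EuclideanSpace ℝ (Fin d)

/-- The dilation `ς^{(t)}(α,x) = t^d ς(α, t x)`. -/
noncomputable def dil (n d : ℕ) (t : ℝ) (ς : (Fin n → ℝ) × Rd d → ℂ) :
    (Fin n → ℝ) × Rd d → ℂ :=
  fun p => ((t ^ d : ℝ) : ℂ) * ς (p.1, t • p.2)

/-- The norm `‖ς‖_{ℬ_ε}`. -/
noncomputable def Bnorm (n d : ℕ) (ε : ℝ) (ς : (Fin n → ℝ) × Rd d → ℂ) : ℝ≥0∞ :=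
  (⨆ i : Fin n, ∫⁻ p : (Fin n → ℝ) × Rd d,
      ENNReal.ofReal ((1 + |p.1 i|) ^ ε) * (‖ς p‖₊ : ℝ≥0∞)) +
  (⨆ i : Fin n, ⨆ h : Set.Ioc (0 : ℝ) 1,
      ENNReal.ofReal ((h : ℝ) ^ (-ε)) *
        ∫⁻ p : (Fin n → ℝ) × Rd d,
          (‖ς (p.1 + (h : ℝ) • (Pi.single i 1 : Fin n → ℝ), p.2) - ς p‖₊ : ℝ≥0∞)) +
  (⨆ h : {h : Rd d // 0 < ‖h‖ ∧ ‖h‖ ≤ 1},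
      ENNReal.ofReal (‖(h : Rd d)‖ ^ (-ε)) *
        ∫⁻ p : (Fin n → ℝ) × Rd d, (‖ς (p.1, p.2 + (h : Rd d)) - ς p‖₊ : ℝ≥0∞)) +
  ∫⁻ p : (Fin n → ℝ) × Rd d, ENNReal.ofReal ((1 + ‖p.2‖) ^ ε) * (‖ς p‖₊ : ℝ≥0∞)

/-- The piecewise linear cutoff equal to `1` on `(-∞, 1/8]` and to `0` on `[1/4, ∞)`. -/
def cutoff (r : ℝ) : ℝ := max 0 (min 1 (2 - 8 * r))

lemma cutoff_nonneg (r : ℝ) : 0 ≤ cutoff r := le_max_left _ _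

lemma cutoff_le_one (r : ℝ) : cutoff r ≤ 1 := max_le zero_le_one (min_le_left _ _)

lemma cutoff_eq_one {r : ℝ} (h : r ≤ 1 / 8) : cutoff r = 1 := by
  rw [cutoff, min_eq_left (by linarith), max_eq_right zero_le_one]

lemma cutoff_eq_zero {r : ℝ} (h : 1 / 4 ≤ r) : cutoff r = 0 := by
  rw [cutoff, max_eq_left ((min_le_right _ _).trans (by linarith))]

lemma abs_cutoff_sub_le (r s : ℝ) : |cutoff r - cutoff s| ≤ 8 * |r - s| := by
  unfold cutoff
  have h1 := abs_max_sub_max_le_abs (min 1 (2 - 8 * r)) (min 1 (2 - 8 * s)) 0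
  have h2 := abs_min_sub_min_le_max 1 (2 - 8 * r) 1 (2 - 8 * s)
  rw [sub_self, abs_zero, max_eq_right (abs_nonneg _),
    show (2 - 8 * r) - (2 - 8 * s) = -(8 * (r - s)) by ring, abs_neg, abs_mul,
    abs_of_pos (by norm_num : (0 : ℝ) < 8)] at h2
  rw [max_comm 0, max_comm 0]
  exact h1.trans h2

/-- The rescaled dyadic partition of unity: `v ↦ shell m (2⁻ᵐ v)` sum to one. -/
def shell {d : ℕ} : ℕ → Rd d → ℝ
  | 0, v => cutoff ‖v‖
  | _ + 1, v => cutoff ‖v‖ - cutoff (2 * ‖v‖)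

section shell

variable {d : ℕ}

lemma abs_shell_le_one (m : ℕ) (v : Rd d) : |shell m v| ≤ 1 := by
  have h1 := cutoff_nonneg ‖v‖
  have h2 := cutoff_le_one ‖v‖
  have h3 := cutoff_nonneg (2 * ‖v‖)
  have h4 := cutoff_le_one (2 * ‖v‖)
  cases m <;> rw [shell, abs_le] <;> constructor <;> linarith

lemma shell_eq_zero (m : ℕ) {v : Rd d} (h : 1 / 4 < ‖v‖) : shell m v = 0 := by
  have h1 := cutoff_eq_zero h.le
  have h2 : cutoff (2 * ‖v‖) = 0 := cutoff_eq_zero (by linarith)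
  cases m <;> simp [shell, h1, h2]

lemma abs_shell_sub_le (m : ℕ) (v w : Rd d) : |shell m v - shell m w| ≤ 24 * ‖v - w‖ := by
  have h0 := abs_norm_sub_norm_le v w
  have h1 := abs_cutoff_sub_le ‖v‖ ‖w‖
  have h2 := abs_cutoff_sub_le (2 * ‖v‖) (2 * ‖w‖)
  rw [← mul_sub, abs_mul, abs_two] at h2
  cases m with
  | zero => rw [shell, shell]; linarith [norm_nonneg (v - w)]
  | succ m =>
    rw [shell, shell, sub_sub_sub_comm]
    linarith [abs_sub (cutoff ‖v‖ - cutoff ‖w‖) (cutoff (2 * ‖v‖) - cutoff (2 * ‖w‖))]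

lemma le_of_shell_ne_zero (m : ℕ) {v : Rd d} (h : shell m v ≠ 0) :
    (2 : ℝ) ^ m ≤ 16 * (1 + ‖(2 : ℝ) ^ m • v‖) := by
  rw [norm_smul, Real.norm_of_nonneg (by positivity)]
  cases m with
  | zero => simp; linarith [norm_nonneg v]
  | succ m =>
    have hv : 1 / 16 ≤ ‖v‖ := by
      by_contra! hv
      exact h (by rw [shell, cutoff_eq_one (by linarith), cutoff_eq_one (by linarith), sub_self])
    have : (0 : ℝ) < 2 ^ (m + 1) := by positivity
    nlinarith

lemma sum_shell (M : ℕ) (v : Rd d) :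
    ∑ m ∈ Finset.range (M + 1), shell m (((2 : ℝ) ^ m)⁻¹ • v) = cutoff (‖v‖ / 2 ^ M) := by
  induction M with
  | zero => simp [shell]
  | succ M ih =>
    rw [Finset.sum_range_succ, ih, shell, norm_smul, Real.norm_of_nonneg (by positivity)]
    have h1 : ((2 : ℝ) ^ (M + 1))⁻¹ * ‖v‖ = ‖v‖ / 2 ^ (M + 1) := by ring
    have h2 : 2 * (‖v‖ / (2 : ℝ) ^ (M + 1)) = ‖v‖ / 2 ^ M := by field_simp; ring
    rw [h1, h2]; ring

lemma shell_continuous (m : ℕ) : Continuous (shell m : Rd d → ℝ) := by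
  have : LipschitzWith 24 (shell m : Rd d → ℝ) := LipschitzWith.of_dist_le_mul fun v w => by
    simpa [dist_eq_norm] using abs_shell_sub_le m v w
  exact this.continuous

lemma exists_norm_div_two_pow_le (v : Rd d) : ∃ M : ℕ, ∀ m ≥ M, ‖v‖ / 2 ^ m ≤ 1 / 16 := by
  have h : Filter.Tendsto (fun m : ℕ => ‖v‖ * (1 / 2 : ℝ) ^ m) Filter.atTop (nhds (‖v‖ * 0)) :=
    (tendsto_pow_atTop_nhds_zero_of_lt_one (by norm_num) (by norm_num)).const_mul _
  rw [mul_zero] at h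
  obtain ⟨M, hM⟩ := Filter.eventually_atTop.1 
    (h.eventually_le_const (by norm_num : (0 : ℝ) < 1 / 16))
  refine ⟨M, fun m hm => ?_⟩
  have := hM m hm
  simp only [one_div, inv_pow] at this
  simpa [div_eq_mul_inv] using this

end shell

section scaling

variable {n d : ℕ}

lemma map_smul_snd {t : ℝ} (ht : 0 < t) :
    (volume : Measure ((Fin n → ℝ) × Rd d)).map (fun p => (p.1, t • p.2)) =
      ENNReal.ofReal ((t ^ d)⁻¹) • volume := by
  have h : (volume : Measure (Rd d)).map (fun v => t • v) =
      ENNReal.ofReal ((t ^ d)⁻¹) • volume := by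
    have := Measure.map_addHaar_smul (volume : Measure (Rd d)) ht.ne'
    rw [finrank_euclideanSpace_fin, abs_of_pos (by positivity)] at this
    exact this
  have h2 := Measure.map_prod_map (volume : Measure (Fin n → ℝ)) (volume : Measure (Rd d))
    measurable_id (measurable_const_smul t)
  rw [Measure.volume_eq_prod]
  refine h2.symm.trans ?_
  rw [Measure.map_id]
  erw [h]
  rw [Measure.prod_smul_right]

lemma measurableEmbedding_smul_snd {t : ℝ} (ht : 0 < t) :
    MeasurableEmbedding (fun p : (Fin n → ℝ) × Rd d => (p.1, t • p.2)) :=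
  ((MeasurableEquiv.refl _).prodCongr (MeasurableEquiv.smul₀ t ht.ne')).measurableEmbedding

lemma lintegral_smul_snd {t : ℝ} (ht : 0 < t) (H : (Fin n → ℝ) × Rd d → ℝ≥0∞) :
    ∫⁻ p : (Fin n → ℝ) × Rd d, ENNReal.ofReal (t ^ d) * H (p.1, t • p.2) = ∫⁻ p, H p := by
  rw [lintegral_const_mul' _ _ ENNReal.ofReal_ne_top,
    ← (measurableEmbedding_smul_snd ht).lintegral_map, map_smul_snd ht, lintegral_smul_measure,
    smul_eq_mul, ← mul_assoc, ← ENNReal.ofReal_mul (by positivity),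
    mul_inv_cancel₀ (by positivity), ENNReal.ofReal_one, one_mul]

lemma quasiMeasurePreserving_smul_snd {t : ℝ} (ht : 0 < t) :
    Measure.QuasiMeasurePreserving (fun p : (Fin n → ℝ) × Rd d => (p.1, t • p.2)) :=
  ⟨(measurableEmbedding_smul_snd ht).measurable, by
    rw [map_smul_snd ht]; exact Measure.smul_absolutelyContinuous⟩

lemma lintegral_enorm_translate_sub_le {F : (Fin n → ℝ) × Rd d → ℂ}
    (hF : AEStronglyMeasurable F volume) (q : (Fin n → ℝ) × Rd d) :
    ∫⁻ p, ‖F (p + q) - F p‖ₑ ≤ 2 * ∫⁻ p, ‖F p‖ₑ := by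
  calc ∫⁻ p, ‖F (p + q) - F p‖ₑ ≤ ∫⁻ p, (‖F (p + q)‖ₑ + ‖F p‖ₑ) :=
        lintegral_mono fun p => enorm_sub_le
    _ = (∫⁻ p, ‖F (p + q)‖ₑ) + ∫⁻ p, ‖F p‖ₑ := lintegral_add_right' _ hF.enorm
    _ = 2 * ∫⁻ p, ‖F p‖ₑ := by
        have : (volume : Measure ((Fin n → ℝ) × Rd d)).IsAddLeftInvariant :=
          inferInstanceAs ((volume : Measure (Fin n → ℝ)).prod
            (volume : Measure (Rd d))).IsAddLeftInvariant
        rw [lintegral_add_right_eq_self (fun p => ‖F p‖ₑ) q, two_mul]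

end scaling

/-- The localisation `t ^ d φ(v) ς(α, t v)`. -/
def localize {n d : ℕ} (t : ℝ) (φ : Rd d → ℝ) (ς : (Fin n → ℝ) × Rd d → ℂ) :
    (Fin n → ℝ) × Rd d → ℂ :=
  fun p => ((t ^ d : ℝ) : ℂ) * ((φ p.2 : ℂ) * ς (p.1, t • p.2))

section localize

variable {n d : ℕ} {t : ℝ} {φ : Rd d → ℝ} {ς : (Fin n → ℝ) × Rd d → ℂ}

lemma enorm_localize (ht : 0 < t) (p : (Fin n → ℝ) × Rd d) :
    ‖localize t φ ς p‖ₑ =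
      ENNReal.ofReal (t ^ d) * (ENNReal.ofReal |φ p.2| * ‖ς (p.1, t • p.2)‖ₑ) := by
  rw [localize, enorm_mul, enorm_mul, ← ofReal_norm ((t ^ d : ℝ) : ℂ),
    ← ofReal_norm ((φ p.2 : ℝ) : ℂ), Complex.norm_real, Complex.norm_real,
    Real.norm_of_nonneg (by positivity), Real.norm_eq_abs]

lemma aestronglyMeasurable_localize (ht : 0 < t) (hφ : Continuous φ)
    (hς : AEStronglyMeasurable ς volume) : AEStronglyMeasurable (localize t φ ς) volume := by
  have h := hς.comp_quasiMeasurePreserving (quasiMeasurePreserving_smul_snd (n := n) (d := d) ht)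
  have h2 : Continuous fun p : (Fin n → ℝ) × Rd d => (φ p.2 : ℂ) := by fun_prop
  exact (h2.aestronglyMeasurable.mul h).const_mul _

/-- Rescaling of weighted integrals. -/
lemma lintegral_mul_enorm_localize_le (ht : 0 < t) {a b : (Fin n → ℝ) × Rd d → ℝ}
    (ha : ∀ p, 0 ≤ a p)
    (hab : ∀ p, a p * |φ p.2| ≤ b (p.1, t • p.2)) :
    ∫⁻ p, ENNReal.ofReal (a p) * ‖localize t φ ς p‖ₑ ≤
      ∫⁻ p, ENNReal.ofReal (b p) * ‖ς p‖ₑ := by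
  rw [← lintegral_smul_snd ht fun p => ENNReal.ofReal (b p) * ‖ς p‖ₑ]
  refine lintegral_mono fun p => ?_
  simp only
  rw [enorm_localize ht, mul_left_comm, ← mul_assoc (ENNReal.ofReal (a p)),
    ← ENNReal.ofReal_mul (ha p)]
  gcongr
  exact hab p

lemma lintegral_enorm_localize_le {ε : ℝ} (hε0 : 0 < ε) (hε1 : ε < 1) (ht : 1 ≤ t)
    (hφ1 : ∀ v, |φ v| ≤ 1)
    (hφt : ∀ v, φ v ≠ 0 → t ≤ 16 * (1 + ‖t • v‖)) :
    ∫⁻ p, ‖localize t φ ς p‖ₑ ≤ ENNReal.ofReal (16 * t ^ (-ε)) * Bnorm n d ε ς := by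
  have ht0 : 0 < t := by linarith
  have h := lintegral_mul_enorm_localize_le (φ := φ) (ς := ς) ht0 (a := fun _ => 1)
    (b := fun p => 16 * t ^ (-ε) * (1 + ‖p.2‖) ^ ε) (fun _ => zero_le_one) (fun p => by
      simp only [one_mul]
      by_cases h0 : φ p.2 = 0
      · rw [h0, abs_zero]; positivity
      refine (hφ1 _).trans ?_
      have h1 : t ^ ε ≤ 16 * (1 + ‖t • p.2‖) ^ ε := by
        calc t ^ ε ≤ (16 * (1 + ‖t • p.2‖)) ^ ε :=
              Real.rpow_le_rpow ht0.le (hφt _ h0) hε0.le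
          _ = 16 ^ ε * (1 + ‖t • p.2‖) ^ ε := Real.mul_rpow (by norm_num) (by positivity)
          _ ≤ 16 ^ (1 : ℝ) * (1 + ‖t • p.2‖) ^ ε := by gcongr; norm_num
          _ = _ := by rw [Real.rpow_one]
      calc (1 : ℝ) = t ^ (-ε) * t ^ ε := by rw [← Real.rpow_add ht0]; simp
        _ ≤ t ^ (-ε) * (16 * (1 + ‖t • p.2‖) ^ ε) := by gcongr
        _ = _ := by ring)
  simp only [ENNReal.ofReal_one, one_mul] at h
  refine h.trans ?_
  have h2 : ∀ p : (Fin n → ℝ) × Rd d, ENNReal.ofReal (16 * t ^ (-ε) * (1 + ‖p.2‖) ^ ε) * ‖ς p‖ₑ =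
      ENNReal.ofReal (16 * t ^ (-ε)) * (ENNReal.ofReal ((1 + ‖p.2‖) ^ ε) * ‖ς p‖ₑ) := fun p => by
    rw [ENNReal.ofReal_mul (by positivity), mul_assoc]
  simp only [h2]
  rw [lintegral_const_mul' _ _ ENNReal.ofReal_ne_top]
  gcongr
  exact le_add_self

end localize

section pieces

variable {n d : ℕ} {ε δ t : ℝ} {φ : Rd d → ℝ} {ς : (Fin n → ℝ) × Rd d → ℂ}

lemma lintegral_fst_weight_le_Bnorm (i : Fin n) :
    ∫⁻ p : (Fin n → ℝ) × Rd d, ENNReal.ofReal ((1 + |p.1 i|) ^ ε) * ‖ς p‖ₑ ≤ Bnorm n d ε ς := by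
  unfold Bnorm
  refine le_trans ?_ (le_add_right (le_add_right (le_add_right le_rfl)))
  exact le_iSup (fun i : Fin n => ∫⁻ p : (Fin n → ℝ) × Rd d,
    ENNReal.ofReal ((1 + |p.1 i|) ^ ε) * (‖ς p‖₊ : ℝ≥0∞)) i

lemma lintegral_snd_weight_le_Bnorm :
    ∫⁻ p : (Fin n → ℝ) × Rd d, ENNReal.ofReal ((1 + ‖p.2‖) ^ ε) * ‖ς p‖ₑ ≤ Bnorm n d ε ς :=
  le_add_self

lemma fst_increment_le_Bnorm (i : Fin n) {h : ℝ} (h0 : 0 < h) (h1 : h ≤ 1) :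
    ∫⁻ p : (Fin n → ℝ) × Rd d, ‖ς (p.1 + h • (Pi.single i 1 : Fin n → ℝ), p.2) - ς p‖ₑ ≤
      ENNReal.ofReal (h ^ ε) * Bnorm n d ε ς := by
  have key : ENNReal.ofReal (h ^ (-ε)) * ∫⁻ p : (Fin n → ℝ) × Rd d,
      ‖ς (p.1 + h • (Pi.single i 1 : Fin n → ℝ), p.2) - ς p‖ₑ ≤ Bnorm n d ε ς := by
    unfold Bnorm
    refine le_trans ?_ (le_add_right (le_add_right (le_add_left le_rfl)))
    exact le_iSup₂ (f := fun (i : Fin n) (h : Set.Ioc (0 : ℝ) 1) =>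
      ENNReal.ofReal ((h : ℝ) ^ (-ε)) * ∫⁻ p : (Fin n → ℝ) × Rd d,
      (‖ς (p.1 + (h : ℝ) • (Pi.single i 1 : Fin n → ℝ), p.2) - ς p‖₊ : ℝ≥0∞)) i ⟨h, h0, h1⟩
  refine le_trans (le_of_eq ?_) (mul_le_mul_right key _)
  rw [← mul_assoc, ← ENNReal.ofReal_mul (by positivity), ← Real.rpow_add h0, add_neg_cancel,
    Real.rpow_zero, ENNReal.ofReal_one, one_mul]

lemma snd_increment_le_Bnorm {h : Rd d} (h0 : 0 < ‖h‖) (h1 : ‖h‖ ≤ 1) :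
    ∫⁻ p : (Fin n → ℝ) × Rd d, ‖ς (p.1, p.2 + h) - ς p‖ₑ ≤
      ENNReal.ofReal (‖h‖ ^ ε) * Bnorm n d ε ς := by
  have key : ENNReal.ofReal (‖h‖ ^ (-ε)) * ∫⁻ p : (Fin n → ℝ) × Rd d,
      ‖ς (p.1, p.2 + h) - ς p‖ₑ ≤ Bnorm n d ε ς := by
    unfold Bnorm
    refine le_trans ?_ (le_add_right (le_add_left le_rfl))
    exact le_iSup (fun h : {h : Rd d // 0 < ‖h‖ ∧ ‖h‖ ≤ 1} =>
      ENNReal.ofReal (‖(h : Rd d)‖ ^ (-ε)) *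
        ∫⁻ p : (Fin n → ℝ) × Rd d, (‖ς (p.1, p.2 + (h : Rd d)) - ς p‖₊ : ℝ≥0∞)) ⟨h, h0, h1⟩
  refine le_trans (le_of_eq ?_) (mul_le_mul_right key _)
  rw [← mul_assoc, ← ENNReal.ofReal_mul (by positivity), ← Real.rpow_add h0, add_neg_cancel,
    Real.rpow_zero, ENNReal.ofReal_one, one_mul]

lemma lintegral_enorm_le_Bnorm (hε0 : 0 < ε) : ∫⁻ p, ‖ς p‖ₑ ≤ Bnorm n d ε ς := by
  refine le_trans (lintegral_mono fun p => ?_) lintegral_snd_weight_le_Bnorm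
  refine le_mul_of_one_le_left (zero_le) ?_
  rw [ENNReal.one_le_ofReal]
  exact Real.one_le_rpow (by linarith [norm_nonneg p.2]) hε0.le

lemma snd_weight_localize_le (hε0 : 0 < ε) (hε1 : ε < 1) (hδ0 : 0 < δ) (hδ : δ < ε / 2)
    (ht : 1 ≤ t) (hφ1 : ∀ v, |φ v| ≤ 1) (hφ0 : ∀ v, 1 / 4 < ‖v‖ → φ v = 0)
    (hφt : ∀ v, φ v ≠ 0 → t ≤ 16 * (1 + ‖t • v‖)) :
    ∫⁻ p : (Fin n → ℝ) × Rd d, ENNReal.ofReal ((1 + ‖p.2‖) ^ δ) * ‖localize t φ ς p‖ₑ ≤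
      ENNReal.ofReal (32 * t ^ (-(ε - 2 * δ))) * Bnorm n d ε ς := by
  have ht0 : 0 < t := by linarith
  calc _ ≤ ∫⁻ p : (Fin n → ℝ) × Rd d, ENNReal.ofReal 2 * ‖localize t φ ς p‖ₑ := by
        refine lintegral_mono fun p => ?_
        by_cases hp : ‖p.2‖ ≤ 1 / 4
        · gcongr
          calc (1 + ‖p.2‖) ^ δ ≤ 2 ^ δ :=
                Real.rpow_le_rpow (by positivity) (by linarith) hδ0.le
            _ ≤ 2 ^ (1 : ℝ) := Real.rpow_le_rpow_of_exponent_le (by norm_num) (by linarith)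
            _ = 2 := Real.rpow_one _
        · simp [localize, hφ0 _ (not_le.1 hp)]
    _ = ENNReal.ofReal 2 * ∫⁻ p : (Fin n → ℝ) × Rd d, ‖localize t φ ς p‖ₑ :=
        lintegral_const_mul' _ _ ENNReal.ofReal_ne_top
    _ ≤ ENNReal.ofReal 2 * (ENNReal.ofReal (16 * t ^ (-ε)) * Bnorm n d ε ς) := by
        gcongr
        exact lintegral_enorm_localize_le hε0 hε1 ht hφ1 hφt
    _ ≤ _ := by
        rw [← mul_assoc, ← ENNReal.ofReal_mul (by norm_num)]
        gcongr ENNReal.ofReal ?_ * _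
        have : t ^ (-ε) ≤ t ^ (-(ε - 2 * δ)) :=
          Real.rpow_le_rpow_of_exponent_le ht (by linarith)
        linarith

lemma fst_weight_localize_le (hε1 : ε < 1) (hδ0 : 0 < δ) (hδ : δ < ε / 2)
    (ht : 1 ≤ t) (hφ1 : ∀ v, |φ v| ≤ 1)
    (hφt : ∀ v, φ v ≠ 0 → t ≤ 16 * (1 + ‖t • v‖)) (hς : AEStronglyMeasurable ς volume)
    (i : Fin n) :
    ∫⁻ p : (Fin n → ℝ) × Rd d, ENNReal.ofReal ((1 + |p.1 i|) ^ δ) * ‖localize t φ ς p‖ₑ ≤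
      ENNReal.ofReal (32 * t ^ (-(ε - 2 * δ))) * Bnorm n d ε ς := by
  have ht0 : 0 < t := by linarith
  set s := ε - 2 * δ with hs
  have hs0 : 0 < s := by linarith
  refine (lintegral_mul_enorm_localize_le ht0 (a := fun p => (1 + |p.1 i|) ^ δ)
    (b := fun p => 16 * t ^ (-s) * ((1 + |p.1 i|) ^ ε + (1 + ‖p.2‖) ^ ε))
    (fun p => by positivity) (fun p => ?_)).trans ?_
  · by_cases h0 : φ p.2 = 0
    · rw [h0, abs_zero, mul_zero]; positivity
    set a := 1 + |p.1 i|
    set b := 1 + ‖t • p.2‖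
    have ha : 1 ≤ a := by simp [a]
    have hb : 1 ≤ b := by simp [b]
    have h1 : t ^ s ≤ 16 * b ^ s := by
      calc t ^ s ≤ (16 * b) ^ s := Real.rpow_le_rpow ht0.le (hφt _ h0) hs0.le
        _ = 16 ^ s * b ^ s := Real.mul_rpow (by norm_num) (by positivity)
        _ ≤ 16 ^ (1 : ℝ) * b ^ s := by
            gcongr
            · norm_num
            · linarith
        _ = _ := by rw [Real.rpow_one]
    have h2 : a ^ δ * b ^ s ≤ a ^ ε + b ^ ε := by
      have hc : 1 ≤ max a b := ha.trans (le_max_left _ _)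
      calc a ^ δ * b ^ s ≤ max a b ^ δ * max a b ^ s := by
            gcongr
            · exact le_max_left _ _
            · exact le_max_right _ _
        _ = max a b ^ (δ + s) := (Real.rpow_add (by positivity) _ _).symm
        _ ≤ max a b ^ ε := Real.rpow_le_rpow_of_exponent_le hc (by linarith)
        _ ≤ a ^ ε + b ^ ε := by
            have : 0 ≤ a ^ ε := by positivity
            have : 0 ≤ b ^ ε := by positivity
            rcases max_choice a b with h | h <;> rw [h] <;> linarith
    calc a ^ δ * |φ p.2| ≤ a ^ δ * 1 := by gcongr; exact hφ1 _
      _ = t ^ (-s) * (a ^ δ * t ^ s) := by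
          rw [mul_left_comm, ← Real.rpow_add ht0]; simp
      _ ≤ t ^ (-s) * (a ^ δ * (16 * b ^ s)) := by gcongr
      _ = 16 * t ^ (-s) * (a ^ δ * b ^ s) := by ring
      _ ≤ 16 * t ^ (-s) * (a ^ ε + b ^ ε) := by gcongr
  · have h2 : ∀ p : (Fin n → ℝ) × Rd d,
        ENNReal.ofReal (16 * t ^ (-s) * ((1 + |p.1 i|) ^ ε + (1 + ‖p.2‖) ^ ε)) * ‖ς p‖ₑ =
        ENNReal.ofReal (16 * t ^ (-s)) * (ENNReal.ofReal ((1 + |p.1 i|) ^ ε) * ‖ς p‖ₑ +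
          ENNReal.ofReal ((1 + ‖p.2‖) ^ ε) * ‖ς p‖ₑ) := fun p => by
      rw [ENNReal.ofReal_mul (by positivity), mul_assoc,
        ENNReal.ofReal_add (by positivity) (by positivity), add_mul]
    simp only [h2]
    rw [lintegral_const_mul' _ _ ENNReal.ofReal_ne_top, lintegral_add_right']
    · calc _ ≤ ENNReal.ofReal (16 * t ^ (-s)) * (Bnorm n d ε ς + Bnorm n d ε ς) := by
            gcongr
            · exact lintegral_fst_weight_le_Bnorm i
            · exact lintegral_snd_weight_le_Bnorm
        _ = _ := by
            rw [← two_mul, ← mul_assoc, show (2 : ℝ≥0∞) = ENNReal.ofReal 2 by simp,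
              ← ENNReal.ofReal_mul (by positivity)]
            congr 2; ring
    · refine AEMeasurable.mul ?_ hς.enorm
      exact (by fun_prop : Measurable fun p : (Fin n → ℝ) × Rd d =>
        ENNReal.ofReal ((1 + ‖p.2‖) ^ ε)).aemeasurable

/-- The increment of the localisation for a large step. -/
lemma increment_localize_le_of_large (hε0 : 0 < ε) (hε1 : ε < 1) (ht : 1 ≤ t)
    (hφ1 : ∀ v, |φ v| ≤ 1) (hφc : Continuous φ)
    (hφt : ∀ v, φ v ≠ 0 → t ≤ 16 * (1 + ‖t • v‖)) (hς : AEStronglyMeasurable ς volume)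
    (q : (Fin n → ℝ) × Rd d) :
    ∫⁻ p : (Fin n → ℝ) × Rd d, ‖localize t φ ς (p + q) - localize t φ ς p‖ₑ ≤
      ENNReal.ofReal (32 * t ^ (-ε)) * Bnorm n d ε ς := by
  have ht0 : 0 < t := by linarith
  refine (lintegral_enorm_translate_sub_le (aestronglyMeasurable_localize ht0 hφc hς) q).trans ?_
  refine (mul_le_mul_right (lintegral_enorm_localize_le hε0 hε1 ht hφ1 hφt) 2).trans (le_of_eq ?_)
  rw [← mul_assoc, show (2 : ℝ≥0∞) = ENNReal.ofReal 2 by simp, ← ENNReal.ofReal_mul (by norm_num)]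
  congr 2; ring

lemma fst_increment_localize_le (hε0 : 0 < ε) (hε1 : ε < 1) (hδ0 : 0 < δ) (hδ : δ < ε / 2)
    (ht : 1 ≤ t) (hφ1 : ∀ v, |φ v| ≤ 1) (hφc : Continuous φ)
    (hφt : ∀ v, φ v ≠ 0 → t ≤ 16 * (1 + ‖t • v‖)) (hς : AEStronglyMeasurable ς volume)
    (i : Fin n) {h : ℝ} (h0 : 0 < h) (h1 : h ≤ 1) :
    ENNReal.ofReal (h ^ (-δ)) * ∫⁻ p : (Fin n → ℝ) × Rd d,
      ‖localize t φ ς (p.1 + h • (Pi.single i 1 : Fin n → ℝ), p.2) - localize t φ ς p‖ₑ ≤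
      ENNReal.ofReal (32 * t ^ (-(ε - 2 * δ))) * Bnorm n d ε ς := by
  have ht0 : 0 < t := by linarith
  have hmono : t ^ (-(ε - δ)) ≤ t ^ (-(ε - 2 * δ)) :=
    Real.rpow_le_rpow_of_exponent_le ht (by linarith)
  have hpos : 0 ≤ t ^ (-(ε - 2 * δ)) := by positivity
  rcases le_total h t⁻¹ with hh | hh
  · have hsmall : ∫⁻ p : (Fin n → ℝ) × Rd d,
        ‖localize t φ ς (p.1 + h • (Pi.single i 1 : Fin n → ℝ), p.2) - localize t φ ς p‖ₑ ≤
        ENNReal.ofReal (h ^ ε) * Bnorm n d ε ς := by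
      refine le_trans ?_ (fst_increment_le_Bnorm i h0 h1)
      rw [← lintegral_smul_snd ht0 (fun p : (Fin n → ℝ) × Rd d =>
        ‖ς (p.1 + h • (Pi.single i 1 : Fin n → ℝ), p.2) - ς p‖ₑ)]
      refine lintegral_mono fun p => ?_
      simp only [localize]
      rw [← mul_sub, ← mul_sub, enorm_mul, enorm_mul, ← ofReal_norm ((t ^ d : ℝ) : ℂ),
        ← ofReal_norm ((φ p.2 : ℝ) : ℂ), Complex.norm_real, Complex.norm_real,
        Real.norm_of_nonneg (by positivity), Real.norm_eq_abs]
      gcongr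
      exact mul_le_of_le_one_left (zero_le) (ENNReal.ofReal_le_one.2 (hφ1 _))
    refine (mul_le_mul_right hsmall _).trans ?_
    rw [← mul_assoc, ← ENNReal.ofReal_mul (by positivity), ← Real.rpow_add h0]
    gcongr ENNReal.ofReal ?_ * _
    calc h ^ (-δ + ε) ≤ t⁻¹ ^ (-δ + ε) := Real.rpow_le_rpow h0.le hh (by linarith)
      _ = t ^ (-(ε - δ)) := by
          rw [Real.inv_rpow ht0.le, ← Real.rpow_neg ht0.le]; congr 1; ring
      _ ≤ _ := by linarith
  · have hlarge := increment_localize_le_of_large hε0 hε1 ht hφ1 hφc hφt hς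
      (h • (Pi.single i 1 : Fin n → ℝ), (0 : Rd d))
    have heq : ∀ p : (Fin n → ℝ) × Rd d, p + (h • (Pi.single i 1 : Fin n → ℝ), (0 : Rd d)) =
        (p.1 + h • (Pi.single i 1 : Fin n → ℝ), p.2) := fun p => by ext <;> simp
    simp only [heq] at hlarge
    refine (mul_le_mul_right hlarge _).trans ?_
    rw [← mul_assoc, ← ENNReal.ofReal_mul (by positivity)]
    gcongr ENNReal.ofReal ?_ * _
    calc h ^ (-δ) * (32 * t ^ (-ε)) ≤ t⁻¹ ^ (-δ) * (32 * t ^ (-ε)) := by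
          gcongr ?_ * _
          exact Real.rpow_le_rpow_of_nonpos (by positivity) hh (by linarith)
      _ = 32 * t ^ (-(ε - δ)) := by
          rw [Real.inv_rpow ht0.le, ← Real.rpow_neg ht0.le, mul_left_comm, ← Real.rpow_add ht0]
          congr 2; ring
      _ ≤ _ := by linarith

lemma snd_increment_localize_le_of_small (hε0 : 0 < ε) (ht : 1 ≤ t) (hφ1 : ∀ v, |φ v| ≤ 1)
    (hφl : ∀ v w, |φ v - φ w| ≤ 24 * ‖v - w‖) (hς : AEStronglyMeasurable ς volume)
    {h : Rd d} (h0 : 0 < ‖h‖) (h1 : t * ‖h‖ ≤ 1) :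
    ∫⁻ p : (Fin n → ℝ) × Rd d, ‖localize t φ ς (p.1, p.2 + h) - localize t φ ς p‖ₑ ≤
      ENNReal.ofReal ((t * ‖h‖) ^ ε + 24 * ‖h‖) * Bnorm n d ε ς := by
  have ht0 : 0 < t := by linarith
  have hn : ‖t • h‖ = t * ‖h‖ := by rw [norm_smul, Real.norm_of_nonneg ht0.le]
  have hinc := snd_increment_le_Bnorm (n := n) (ε := ε) (ς := ς) (h := t • h)
    (by rw [hn]; positivity) (by rwa [hn])
  rw [hn] at hinc
  calc _ ≤ ∫⁻ p : (Fin n → ℝ) × Rd d, ENNReal.ofReal (t ^ d) *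
        (‖ς (p.1, t • p.2 + t • h) - ς (p.1, t • p.2)‖ₑ +
          ENNReal.ofReal (24 * ‖h‖) * ‖ς (p.1, t • p.2)‖ₑ) := by
        refine lintegral_mono fun p => ?_
        simp only [localize]
        have hsplit : (φ (p.2 + h) : ℂ) * ς (p.1, t • (p.2 + h)) - (φ p.2 : ℂ) * ς (p.1, t • p.2) =
            (φ (p.2 + h) : ℂ) * (ς (p.1, t • p.2 + t • h) - ς (p.1, t • p.2)) +
            ((φ (p.2 + h) - φ p.2 : ℝ) : ℂ) * ς (p.1, t • p.2) := by
          rw [smul_add]; push_cast; ring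
        rw [← mul_sub, hsplit, enorm_mul, ← ofReal_norm ((t ^ d : ℝ) : ℂ),
          Complex.norm_real, Real.norm_of_nonneg (by positivity)]
        gcongr
        refine (enorm_add_le _ _).trans ?_
        rw [enorm_mul, enorm_mul, ← ofReal_norm ((φ (p.2 + h) : ℝ) : ℂ),
          ← ofReal_norm ((φ (p.2 + h) - φ p.2 : ℝ) : ℂ), Complex.norm_real,
          Complex.norm_real, Real.norm_eq_abs, Real.norm_eq_abs]
        gcongr
        · exact mul_le_of_le_one_left (zero_le) (ENNReal.ofReal_le_one.2 (hφ1 _))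
        · simpa using hφl (p.2 + h) p.2
    _ = ∫⁻ p : (Fin n → ℝ) × Rd d, (‖ς (p.1, p.2 + t • h) - ς p‖ₑ +
          ENNReal.ofReal (24 * ‖h‖) * ‖ς p‖ₑ) :=
        lintegral_smul_snd ht0 (fun p : (Fin n → ℝ) × Rd d => ‖ς (p.1, p.2 + t • h) - ς p‖ₑ +
          ENNReal.ofReal (24 * ‖h‖) * ‖ς p‖ₑ)
    _ = (∫⁻ p : (Fin n → ℝ) × Rd d, ‖ς (p.1, p.2 + t • h) - ς p‖ₑ) +
          ENNReal.ofReal (24 * ‖h‖) * ∫⁻ p, ‖ς p‖ₑ := by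
        rw [lintegral_add_right' _ (hς.enorm.const_mul _),
          lintegral_const_mul' _ _ ENNReal.ofReal_ne_top]
    _ ≤ ENNReal.ofReal ((t * ‖h‖) ^ ε) * Bnorm n d ε ς +
          ENNReal.ofReal (24 * ‖h‖) * Bnorm n d ε ς := by
        gcongr
        exact lintegral_enorm_le_Bnorm hε0
    _ = _ := by rw [ENNReal.ofReal_add (by positivity) (by positivity), add_mul]

lemma snd_increment_localize_le (hε0 : 0 < ε) (hε1 : ε < 1) (hδ0 : 0 < δ) (hδ : δ < ε / 2)
    (ht : 1 ≤ t) (hφ1 : ∀ v, |φ v| ≤ 1) (hφc : Continuous φ)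
    (hφl : ∀ v w, |φ v - φ w| ≤ 24 * ‖v - w‖)
    (hφt : ∀ v, φ v ≠ 0 → t ≤ 16 * (1 + ‖t • v‖)) (hς : AEStronglyMeasurable ς volume)
    {h : Rd d} (h0 : 0 < ‖h‖) :
    ENNReal.ofReal (‖h‖ ^ (-δ)) * ∫⁻ p : (Fin n → ℝ) × Rd d,
      ‖localize t φ ς (p.1, p.2 + h) - localize t φ ς p‖ₑ ≤
      ENNReal.ofReal (32 * t ^ (-(ε - 2 * δ))) * Bnorm n d ε ς := by
  have ht0 : 0 < t := by linarith
  have hpos : 0 ≤ t ^ (-(ε - 2 * δ)) := by positivity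
  have hsq : ∀ x : ℝ, (t ^ (-2 : ℝ)) ^ x = t ^ (-2 * x) := fun x => (Real.rpow_mul ht0.le _ _).symm
  rcases le_total ‖h‖ (t ^ (-2 : ℝ)) with hh | hh
  · have hth : t * ‖h‖ ≤ 1 := by
      calc t * ‖h‖ ≤ t ^ (1 : ℝ) * t ^ (-2 : ℝ) := by rw [Real.rpow_one]; gcongr
        _ = t ^ (-1 : ℝ) := by rw [← Real.rpow_add ht0]; norm_num
        _ ≤ 1 := Real.rpow_le_one_of_one_le_of_nonpos ht (by norm_num)
    refine (mul_le_mul_right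
      (snd_increment_localize_le_of_small hε0 ht hφ1 hφl hς h0 hth) _).trans ?_
    rw [← mul_assoc, ← ENNReal.ofReal_mul (by positivity)]
    gcongr ENNReal.ofReal ?_ * _
    have e1 : ‖h‖ ^ (-δ) * (t * ‖h‖) ^ ε ≤ t ^ (-(ε - 2 * δ)) := by
      calc ‖h‖ ^ (-δ) * (t * ‖h‖) ^ ε = t ^ ε * ‖h‖ ^ (-δ + ε) := by
            rw [Real.mul_rpow ht0.le h0.le, Real.rpow_add h0]; ring
        _ ≤ t ^ ε * (t ^ (-2 : ℝ)) ^ (-δ + ε) := by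
            gcongr
            linarith
        _ = t ^ (-(ε - 2 * δ)) := by rw [hsq, ← Real.rpow_add ht0]; congr 1; ring
    have e2 : ‖h‖ ^ (-δ) * ‖h‖ ≤ t ^ (-(ε - 2 * δ)) := by
      calc ‖h‖ ^ (-δ) * ‖h‖ = ‖h‖ ^ (-δ + 1) := by rw [Real.rpow_add h0, Real.rpow_one]
        _ ≤ (t ^ (-2 : ℝ)) ^ (-δ + 1) := Real.rpow_le_rpow h0.le hh (by linarith)
        _ = t ^ (-2 * (-δ + 1)) := hsq _
        _ ≤ t ^ (-(ε - 2 * δ)) := Real.rpow_le_rpow_of_exponent_le ht (by linarith)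
    linarith
  · have hlarge := increment_localize_le_of_large hε0 hε1 ht hφ1 hφc hφt hς
      ((0 : Fin n → ℝ), h)
    have heq : ∀ p : (Fin n → ℝ) × Rd d, p + ((0 : Fin n → ℝ), h) = (p.1, p.2 + h) :=
      fun p => by ext <;> simp
    simp only [heq] at hlarge
    refine (mul_le_mul_right hlarge _).trans ?_
    rw [← mul_assoc, ← ENNReal.ofReal_mul (by positivity)]
    gcongr ENNReal.ofReal ?_ * _
    calc ‖h‖ ^ (-δ) * (32 * t ^ (-ε)) ≤ (t ^ (-2 : ℝ)) ^ (-δ) * (32 * t ^ (-ε)) := by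
          gcongr ?_ * _
          exact Real.rpow_le_rpow_of_nonpos (by positivity) hh (by linarith)
      _ = 32 * t ^ (-(ε - 2 * δ)) := by
          rw [hsq, mul_left_comm, ← Real.rpow_add ht0]; congr 2; ring
      _ ≤ _ := le_rfl

lemma Bnorm_localize_le (hε0 : 0 < ε) (hε1 : ε < 1) (hδ0 : 0 < δ) (hδ : δ < ε / 2)
    (ht : 1 ≤ t) (hφ1 : ∀ v, |φ v| ≤ 1) (hφ0 : ∀ v, 1 / 4 < ‖v‖ → φ v = 0) (hφc : Continuous φ)
    (hφl : ∀ v w, |φ v - φ w| ≤ 24 * ‖v - w‖)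
    (hφt : ∀ v, φ v ≠ 0 → t ≤ 16 * (1 + ‖t • v‖)) (hς : AEStronglyMeasurable ς volume) :
    Bnorm n d δ (localize t φ ς) ≤
      ENNReal.ofReal (128 * t ^ (-(ε - 2 * δ))) * Bnorm n d ε ς := by
  have ht0 : 0 < t := by linarith
  have e : ENNReal.ofReal (128 * t ^ (-(ε - 2 * δ))) * Bnorm n d ε ς =
      ENNReal.ofReal (32 * t ^ (-(ε - 2 * δ))) * Bnorm n d ε ς +
      ENNReal.ofReal (32 * t ^ (-(ε - 2 * δ))) * Bnorm n d ε ς +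
      ENNReal.ofReal (32 * t ^ (-(ε - 2 * δ))) * Bnorm n d ε ς +
      ENNReal.ofReal (32 * t ^ (-(ε - 2 * δ))) * Bnorm n d ε ς := by
    rw [← add_mul, ← add_mul, ← add_mul, ← ENNReal.ofReal_add (by positivity) (by positivity),
      ← ENNReal.ofReal_add (by positivity) (by positivity),
      ← ENNReal.ofReal_add (by positivity) (by positivity)]
    congr 2; ring
  rw [e, Bnorm.eq_def n d δ]
  refine add_le_add (add_le_add (add_le_add ?_ ?_) ?_) ?_
  · exact iSup_le fun i => fst_weight_localize_le hε1 hδ0 hδ ht hφ1 hφt hς i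
  · exact iSup₂_le fun i h =>
      fst_increment_localize_le hε0 hε1 hδ0 hδ ht hφ1 hφc hφt hς i h.2.1 h.2.2
  · exact iSup_le fun h =>
      snd_increment_localize_le hε0 hε1 hδ0 hδ ht hφ1 hφc hφl hφt hς h.2.1
  · exact snd_weight_localize_le hε0 hε1 hδ0 hδ ht hφ1 hφ0 hφt

lemma integrable_localize (hε0 : 0 < ε) (hε1 : ε < 1) (ht : 1 ≤ t) (hφ1 : ∀ v, |φ v| ≤ 1)
    (hφc : Continuous φ) (hφt : ∀ v, φ v ≠ 0 → t ≤ 16 * (1 + ‖t • v‖))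
    (hς : AEStronglyMeasurable ς volume) (hB : Bnorm n d ε ς ≠ ⊤) :
    Integrable (localize t φ ς) volume :=
  ⟨aestronglyMeasurable_localize (by linarith) hφc hς,
    (lintegral_enorm_localize_le hε0 hε1 ht hφ1 hφt).trans_lt
      (ENNReal.mul_lt_top ENNReal.ofReal_lt_top hB.lt_top)⟩

lemma dil_localize (ht : 0 < t) (p : (Fin n → ℝ) × Rd d) :
    dil n d t⁻¹ (localize t φ ς) p = (φ (t⁻¹ • p.2) : ℂ) * ς p := by
  simp only [dil, localize]
  rw [smul_inv_smul₀ ht.ne', ← mul_assoc, ← Complex.ofReal_mul, ← mul_pow, inv_mul_cancel₀ ht.ne']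
  simp

end pieces

/-- the decomposition Lemma 4.13: `ς = Σ_{m≥0} ς_m^{(2^{−m})}` with
`ς_m` supported in `{|v| ≤ 1/4}` and `‖ς_m‖_{ℬ_δ} ≤ C 2^{−m(ε−2δ)} ‖ς‖_{ℬ_ε}`,
the series converging absolutely a.e. and in `L¹`. -/
theorem statement11 (d : ℕ) (hd : 1 ≤ d) (ε δ : ℝ) (hε0 : 0 < ε) (hε1 : ε < 1)
    (hδ0 : 0 < δ) (hδ : δ < ε / 2) :
    ∃ C : ℝ, 0 < C ∧ ∀ n : ℕ, 1 ≤ n →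
      ∀ ς : (Fin n → ℝ) × Rd d → ℂ, Integrable ς volume → Bnorm n d ε ς ≠ ⊤ →
      ∃ ςm : ℕ → (Fin n → ℝ) × Rd d → ℂ,
        (∀ m, Integrable (ςm m) volume) ∧
        (∀ m, ∀ p : (Fin n → ℝ) × Rd d, (1 : ℝ) / 4 < ‖p.2‖ → ςm m p = 0) ∧
        (∀ m : ℕ, Bnorm n d δ (ςm m) ≤
          ENNReal.ofReal (C * 2 ^ (-(m : ℝ) * (ε - 2 * δ))) * Bnorm n d ε ς) ∧
        (∀ᵐ p ∂(volume : Measure ((Fin n → ℝ) × Rd d)),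
          Summable (fun m : ℕ => ‖dil n d (((2 : ℝ) ^ m)⁻¹) (ςm m) p‖) ∧
          HasSum (fun m : ℕ => dil n d (((2 : ℝ) ^ m)⁻¹) (ςm m) p) (ς p)) ∧
        Filter.Tendsto (fun M : ℕ =>
            ∫⁻ p : (Fin n → ℝ) × Rd d,
              (‖(∑ m ∈ Finset.range M, dil n d (((2 : ℝ) ^ m)⁻¹) (ςm m) p) - ς p‖₊ : ℝ≥0∞))
          Filter.atTop (nhds 0) := by
  refine ⟨128, by norm_num, fun n _ ς hς hB => ?_⟩
  have hone : ∀ m : ℕ, (1 : ℝ) ≤ 2 ^ m := fun m => one_le_pow₀ one_le_two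
  have hdil : ∀ (m : ℕ) (p : (Fin n → ℝ) × Rd d),
      dil n d (((2 : ℝ) ^ m)⁻¹) (localize (2 ^ m) (shell m) ς) p =
        (shell m (((2 : ℝ) ^ m)⁻¹ • p.2) : ℂ) * ς p := fun m p => dil_localize (by positivity) p
  have hsum : ∀ (M : ℕ) (p : (Fin n → ℝ) × Rd d),
      ∑ m ∈ Finset.range (M + 1), dil n d (((2 : ℝ) ^ m)⁻¹) (localize (2 ^ m) (shell m) ς) p =
        (cutoff (‖p.2‖ / 2 ^ M) : ℂ) * ς p := fun M p => by
    simp only [hdil]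
    rw [← Finset.sum_mul, ← Complex.ofReal_sum, sum_shell]
  refine ⟨fun m => localize (2 ^ m) (shell m) ς, fun m => ?_, fun m p hp => ?_, fun m => ?_,
    Filter.Eventually.of_forall fun p => ?_, ?_⟩
  · exact integrable_localize hε0 hε1 (hone m) (abs_shell_le_one m) (shell_continuous m)
      (fun v => le_of_shell_ne_zero m) hς.1 hB
  · simp [localize, shell_eq_zero m hp]
  · refine (Bnorm_localize_le hε0 hε1 hδ0 hδ (hone m) (abs_shell_le_one m)
      (fun v => shell_eq_zero m) (shell_continuous m) (abs_shell_sub_le m)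
      (fun v => le_of_shell_ne_zero m) hς.1).trans (le_of_eq ?_)
    rw [← Real.rpow_natCast, ← Real.rpow_mul zero_le_two, mul_neg, neg_mul]
  · obtain ⟨M, hM⟩ := exists_norm_div_two_pow_le p.2
    have hzero : ∀ m ∉ Finset.range (M + 1),
        dil n d (((2 : ℝ) ^ m)⁻¹) (localize (2 ^ m) (shell m) ς) p = 0 := fun m hm => by
      rw [Finset.mem_range, not_lt] at hm
      obtain ⟨k, rfl⟩ : ∃ k, m = k + 1 := ⟨m - 1, by omega⟩
      have h1 : ‖((2 : ℝ) ^ (k + 1))⁻¹ • p.2‖ ≤ 1 / 16 := by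
        rw [norm_smul, Real.norm_of_nonneg (by positivity), mul_comm, ← div_eq_mul_inv]
        exact hM _ (by omega)
      rw [hdil, shell, cutoff_eq_one (by linarith), cutoff_eq_one (by linarith)]
      simp
    refine ⟨summable_of_ne_finset_zero (s := Finset.range (M + 1)) fun m hm => by
      rw [hzero m hm, norm_zero], ?_⟩
    have h := hasSum_sum_of_ne_finset_zero (L := .unconditional ℕ) hzero
    rwa [hsum, cutoff_eq_one (by linarith [hM M le_rfl]), Complex.ofReal_one, one_mul] at h
  · rw [← Filter.tendsto_add_atTop_iff_nat 1]
    simp only [hsum]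
    have hcont : Continuous cutoff := by unfold cutoff; fun_prop
    have hlim := tendsto_lintegral_of_dominated_convergence' (μ := volume)
      (F := fun (M : ℕ) (p : (Fin n → ℝ) × Rd d) => ‖(cutoff (‖p.2‖ / 2 ^ M) : ℂ) * ς p - ς p‖ₑ)
      (f := fun _ => 0) (fun p => ‖ς p‖ₑ) (fun M => ?_)
      (fun M => Filter.Eventually.of_forall fun p => ?_) hς.2.ne
      (Filter.Eventually.of_forall fun p => ?_)
    · rw [lintegral_zero] at hlim
      exact hlim
    · have h2 : Continuous fun p : (Fin n → ℝ) × Rd d => (cutoff (‖p.2‖ / 2 ^ M) : ℂ) := by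
        fun_prop
      exact ((h2.aestronglyMeasurable.mul hς.1).sub hς.1).enorm
    · have h3 : (cutoff (‖p.2‖ / 2 ^ M) : ℂ) * ς p - ς p =
          ((cutoff (‖p.2‖ / 2 ^ M) - 1 : ℝ) : ℂ) * ς p := by push_cast; ring
      simp only
      rw [h3, enorm_mul, ← ofReal_norm (Complex.ofReal _), Complex.norm_real,
        Real.norm_eq_abs]
      refine mul_le_of_le_one_left (zero_le) (ENNReal.ofReal_le_one.2 ?_)
      rw [abs_le]
      constructor <;>
        linarith [cutoff_nonneg (‖p.2‖ / 2 ^ M), cutoff_le_one (‖p.2‖ / 2 ^ M)]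
    · obtain ⟨M, hM⟩ := exists_norm_div_two_pow_le p.2
      refine tendsto_const_nhds.congr' ?_
      filter_upwards [Filter.eventually_ge_atTop M] with m hm
      rw [cutoff_eq_one (by linarith [hM m hm])]
      simp

end
end

section
/- For every ε > 0, α > 0 and β ≥ 0 there is a constant C = C(ε, α, β) such that for all real numbers U, V ≥ 1: Σ_{k=0}^∞ (min{2^{−kε} U, 1})^α · (log(2^k + V))^β ≤ C · log(1+U) · (log(1+U+V))^β. -/
open MeasureTheory
open scoped ENNReal NNReal

/-- A geometric sequence remains summable after multiplication by a real power. -/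
lemma summable_geometric_mul_one_add_rpow {r : ℝ} (hr0 : 0 < r) (hr1 : r < 1) (β : ℝ) :
    Summable fun j : ℕ => r ^ j * (1 + (j : ℝ)) ^ β := by
  have h := summable_pow_mul_geometric_of_norm_lt_one (R := ℝ) ⌈β⌉₊ (r := r)
    (by rwa [Real.norm_eq_abs, abs_of_pos hr0])
  have h' := ((summable_nat_add_iff 1).mpr h).mul_left r⁻¹
  refine Summable.of_nonneg_of_le (fun j => by positivity) (fun j => ?_) h'
  have hpow : (1 + (j : ℝ)) ^ β ≤ (1 + (j : ℝ)) ^ ⌈β⌉₊ := by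
    rw [← Real.rpow_natCast]
    exact Real.rpow_le_rpow_of_exponent_le (by simp) (Nat.le_ceil β)
  calc r ^ j * (1 + (j : ℝ)) ^ β ≤ r ^ j * (1 + (j : ℝ)) ^ ⌈β⌉₊ := by gcongr
    _ = _ := by
      push_cast
      field_simp
      ring

/-- Splitting a series with truncated index into its constant head and its tail. -/
lemma ENNReal.tsum_comp_nat_sub (g : ℕ → ℝ≥0∞) (N : ℕ) :
    ∑' k : ℕ, g (k - N) = N * g 0 + ∑' j : ℕ, g j := by
  induction N with
  | zero => simp
  | succ n ih =>
    rw [tsum_eq_zero_add' ENNReal.summable]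
    simp only [Nat.add_sub_add_right, ih]
    simp
    ring

/-- The logarithmic factor grows at most linearly beyond the index `N`. -/
lemma log_two_pow_add_le {ε U V : ℝ} (hε : 0 < ε) (hU : 1 ≤ U) (hV : 1 ≤ V) {N : ℕ}
    (hN : N * Real.log 2 ≤ Real.log 2 + Real.log U / ε) (k : ℕ) :
    Real.log ((2 : ℝ) ^ k + V) ≤
      (2 + 1 / ε) * (1 + ((k - N : ℕ) : ℝ)) * Real.log (1 + U + V) := by
  have hpow : (1 : ℝ) ≤ 2 ^ k := one_le_pow₀ (by norm_num)
  have hlog : Real.log ((2 : ℝ) ^ k + V) ≤ k * Real.log 2 + Real.log (1 + U + V) := by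
    rw [← Real.log_pow, ← Real.log_mul (by positivity) (by positivity)]
    exact Real.log_le_log (by positivity) (by nlinarith)
  have hk : (k : ℝ) ≤ N + ((k - N : ℕ) : ℝ) := by
    exact_mod_cast (by omega : k ≤ N + (k - N))
  set j : ℝ := ((k - N : ℕ) : ℝ)
  set L := Real.log (1 + U + V)
  have hj : 0 ≤ j := Nat.cast_nonneg _
  have h2 : Real.log 2 ≤ L := Real.log_le_log (by norm_num) (by linarith)
  have hL : 0 ≤ L := (Real.log_nonneg (by norm_num)).trans h2
  have hUL : Real.log U / ε ≤ L / ε := by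
    have : Real.log U ≤ L := Real.log_le_log (by linarith) (by linarith)
    gcongr
  have hkl : k * Real.log 2 ≤ (N + j) * Real.log 2 :=
    mul_le_mul_of_nonneg_right hk (Real.log_nonneg (by norm_num))
  have hjl : j * Real.log 2 ≤ j * L := mul_le_mul_of_nonneg_left h2 hj
  have hjL : 0 ≤ j * L := mul_nonneg hj hL
  have hjε : 0 ≤ j * L / ε := by positivity
  have : (2 + 1 / ε) * (1 + j) * L = 2 * L + L / ε + 2 * (j * L) + j * L / ε := by ring
  linarith

/-- The truncated factor decays geometrically beyond the index `N`. -/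
lemma min_two_rpow_mul_rpow_le {ε α U : ℝ} (hα : 0 < α) (hU : 1 ≤ U) {N : ℕ}
    (hN : U ≤ (2 : ℝ) ^ (N * ε)) (k : ℕ) :
    (min ((2 : ℝ) ^ (-(k : ℝ) * ε) * U) 1) ^ α ≤ ((2 : ℝ) ^ (-(ε * α))) ^ (k - N) := by
  have h0 : 0 ≤ min ((2 : ℝ) ^ (-(k : ℝ) * ε) * U) 1 := by positivity
  rcases le_total k N with hk | hk
  · rw [Nat.sub_eq_zero_of_le hk, pow_zero]
    exact Real.rpow_le_one h0 (min_le_right _ _) hα.le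
  · calc (min ((2 : ℝ) ^ (-(k : ℝ) * ε) * U) 1) ^ α
        ≤ ((2 : ℝ) ^ (-(k : ℝ) * ε) * 2 ^ (N * ε)) ^ α := by
          refine Real.rpow_le_rpow h0 ((min_le_left _ _).trans ?_) hα.le
          gcongr
      _ = ((2 : ℝ) ^ (-(ε * α))) ^ (k - N) := by
          rw [← Real.rpow_add two_pos, ← Real.rpow_mul two_pos.le, ← Real.rpow_natCast,
            ← Real.rpow_mul two_pos.le, Nat.cast_sub hk]
          ring_nf

/-- For every `ε > 0`, `α > 0`, `β ≥ 0` there is a constant `C = C(ε, α, β)`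
such that for all real `U, V ≥ 1`:
`Σ_{k=0}^∞ (min{2^{−kε} U, 1})^α (log(2^k + V))^β ≤ C log(1+U) (log(1+U+V))^β`. -/
theorem statement17 (ε α β : ℝ) (hε : 0 < ε) (hα : 0 < α) (hβ : 0 ≤ β) :
    ∃ C : ℝ, 0 < C ∧ ∀ U V : ℝ, 1 ≤ U → 1 ≤ V →
      (∑' k : ℕ, ENNReal.ofReal
          ((min ((2 : ℝ) ^ (-(k : ℝ) * ε) * U) 1) ^ α *
            Real.log ((2 : ℝ) ^ k + V) ^ β)) ≤
        ENNReal.ofReal (C * Real.log (1 + U) * Real.log (1 + U + V) ^ β) := by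
  set r : ℝ := (2 : ℝ) ^ (-(ε * α))
  have hr0 : 0 < r := by positivity
  have hr1 : r < 1 :=
    Real.rpow_lt_one_of_one_lt_of_neg one_lt_two (neg_lt_zero.mpr (mul_pos hε hα))
  set g : ℕ → ℝ := fun j => r ^ j * (1 + (j : ℝ)) ^ β with hg
  have hg0 : ∀ j, 0 ≤ g j := fun j => by positivity
  have hgs : Summable g := summable_geometric_mul_one_add_rpow hr0 hr1 β
  set S := ∑' j, g j
  have hS : 0 ≤ S := tsum_nonneg hg0
  have hl2 : 0 < Real.log 2 := Real.log_pos one_lt_two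
  refine ⟨(2 + 1 / ε) ^ β * ((1 + 1 / ε + S) / Real.log 2), by positivity, fun U V hU hV => ?_⟩
  have hlU : 0 ≤ Real.log U := Real.log_nonneg hU
  set L := Real.log (1 + U + V)
  have hL : 0 ≤ L := Real.log_nonneg (by linarith)
  set N := ⌈Real.log U / (ε * Real.log 2)⌉₊
  have hNlow : Real.log U / (ε * Real.log 2) ≤ N := Nat.le_ceil _
  have hNup : (N : ℝ) < Real.log U / (ε * Real.log 2) + 1 := Nat.ceil_lt_add_one (by positivity)
  have hN1 : N * Real.log 2 ≤ Real.log 2 + Real.log U / ε := by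
    have := mul_le_mul_of_nonneg_right hNup.le hl2.le
    have h : (Real.log U / (ε * Real.log 2) + 1) * Real.log 2 =
        Real.log 2 + Real.log U / ε := by
      field_simp
      ring
    linarith
  have hN2 : U ≤ (2 : ℝ) ^ (N * ε) := by
    rw [Real.le_rpow_iff_log_le (by linarith) two_pos, mul_assoc]
    exact (div_le_iff₀ (by positivity)).mp hNlow
  have hterm : ∀ k : ℕ, (min ((2 : ℝ) ^ (-(k : ℝ) * ε) * U) 1) ^ α *
      Real.log ((2 : ℝ) ^ k + V) ^ β ≤ (2 + 1 / ε) ^ β * L ^ β * g (k - N) := by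
    intro k
    have hlog : 0 ≤ Real.log ((2 : ℝ) ^ k + V) :=
      Real.log_nonneg (by linarith [pow_pos (two_pos (α := ℝ)) k])
    calc _ ≤ r ^ (k - N) * ((2 + 1 / ε) * (1 + ((k - N : ℕ) : ℝ)) * L) ^ β :=
          mul_le_mul (min_two_rpow_mul_rpow_le hα hU hN2 k)
            (Real.rpow_le_rpow hlog (log_two_pow_add_le hε hU hV hN1 k) hβ)
            (Real.rpow_nonneg hlog β) (by positivity)
      _ = _ := by
          rw [Real.mul_rpow (by positivity) hL, Real.mul_rpow (by positivity) (by positivity)]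
          ring
  have hcount : N + S ≤ (1 + 1 / ε + S) / Real.log 2 * Real.log (1 + U) := by
    have h2 : Real.log 2 ≤ Real.log (1 + U) := Real.log_le_log two_pos (by linarith)
    have hU' : Real.log U / ε ≤ Real.log (1 + U) / ε := by
      have : Real.log U ≤ Real.log (1 + U) := Real.log_le_log (by linarith) (by linarith)
      gcongr
    have hS2 := mul_le_mul_of_nonneg_left h2 hS
    rw [div_mul_eq_mul_div, le_div_iff₀ hl2]
    have : (1 + 1 / ε + S) * Real.log (1 + U) =
        Real.log (1 + U) + Real.log (1 + U) / ε + S * Real.log (1 + U) := by ring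
    linarith
  calc _ ≤ ∑' k : ℕ, ENNReal.ofReal ((2 + 1 / ε) ^ β * L ^ β) * ENNReal.ofReal (g (k - N)) := by
        refine ENNReal.tsum_le_tsum fun k => ?_
        rw [← ENNReal.ofReal_mul (by positivity)]
        exact ENNReal.ofReal_le_ofReal (hterm k)
    _ = ENNReal.ofReal ((2 + 1 / ε) ^ β * L ^ β * (N + S)) := by
        have h0 : g 0 = 1 := by simp [hg]
        rw [ENNReal.tsum_mul_left, ENNReal.tsum_comp_nat_sub (fun j => ENNReal.ofReal (g j)), h0,
          ← ENNReal.ofReal_tsum_of_nonneg hg0 hgs,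
          ENNReal.ofReal_mul (p := (2 + 1 / ε) ^ β * L ^ β) (q := N + S) (by positivity),
          ENNReal.ofReal_add (by positivity) hS]
        simp [S]
    _ ≤ _ := by
        refine ENNReal.ofReal_le_ofReal ?_
        calc _ ≤ (2 + 1 / ε) ^ β * L ^ β *
              ((1 + 1 / ε + S) / Real.log 2 * Real.log (1 + U)) := by gcongr
          _ = _ := by ring
end
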